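/- Let x₁,…,x_n ∈ ℝ^d be nonzero with X = (x₁,…,x_n) ∈ ℝ^{d×n}, let μ = λ_min((1/n)XX^T) be the smallest eigenvalue of (1/n)XX^T and λ_avg = trace((1/n)XX^T)/d its average eigenvalue. Let w* ∈ ℝ^d, yᵢ = ⟨xᵢ, w*⟩, and fix w⁰ ∈ ℝ^d. For an index sequence ι ∈ {1,…,n}^k, define w^{t+1}(ι) = w^t(ι) − (1/‖x_{ι_t}‖²)(⟨x_{ι_t}, w^t(ι)⟩ − y_{ι_t}) x_{ι_t}. Then the expectation over ι drawn with independent coordinates, each distributed with P(i) = ‖xᵢ‖²/‖X‖_F², satisfies E‖w^k − w*‖² ≤ (1 − μ/(d·λ_avg))^k ‖w⁰ − w*‖². -/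

import Mathlib

/-- The smallest eigenvalue of a real symmetric matrix bounds its quadratic form from below. -/
theorem Matrix.IsHermitian.iInf_eigenvalues_mul_dotProduct_le {m : Type*} [Fintype m]
    [DecidableEq m] {A : Matrix m m ℝ} (hA : A.IsHermitian) (v : m → ℝ) :
    (⨅ a, hA.eigenvalues a) * (v ⬝ᵥ v) ≤ v ⬝ᵥ A.mulVec v := by
  set c := ⨅ a, hA.eigenvalues a with hc
  have hpsd : (A - algebraMap ℝ (Matrix m m ℝ) c).PosSemidef := by
    rw [Matrix.posSemidef_iff_isHermitian_and_spectrum_nonneg]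
    refine ⟨hA.sub ?_, ?_⟩
    · rw [Algebra.algebraMap_eq_smul_one]
      exact Matrix.isHermitian_one.smul (IsSelfAdjoint.all c)
    · rw [← spectrum.sub_singleton_eq, hA.spectrum_real_eq_range_eigenvalues]
      rintro _ ⟨_, ⟨a, rfl⟩, _, rfl, rfl⟩
      exact sub_nonneg.2 (ciInf_le (Set.finite_range hA.eigenvalues).bddBelow a)
  have h := hpsd.dotProduct_mulVec_nonneg v
  rw [Algebra.algebraMap_eq_smul_one, Matrix.sub_mulVec, Matrix.smul_mulVec, Matrix.one_mulVec,
    dotProduct_sub, dotProduct_smul, star_trivial, smul_eq_mul] at h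
  linarith

/-- Projecting `e` onto the orthogonal complement of `u` decreases the squared norm by
`⟨u, e⟩² / ‖u‖²`. -/
theorem sum_sq_sub_proj {m : Type*} [Fintype m] (u e : m → ℝ) (hu : ∑ b, u b ^ 2 ≠ 0) :
    ∑ a, (e a - (∑ b, u b * e b) / (∑ b, u b ^ 2) * u a) ^ 2
      = ∑ a, e a ^ 2 - (∑ b, u b * e b) ^ 2 / ∑ b, u b ^ 2 := by
  set s := ∑ b, u b * e b with hs
  set q := ∑ b, u b ^ 2 with hq
  have h : ∀ a, (e a - s / q * u a) ^ 2
      = e a ^ 2 - 2 * (s / q) * (u a * e a) + (s / q) ^ 2 * u a ^ 2 := fun a => by ring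
  simp_rw [h, Finset.sum_add_distrib, Finset.sum_sub_distrib, ← Finset.mul_sum, ← hs, ← hq]
  field_simp
  ring

/-- If one random step, drawn with weights `p`, contracts `f` by `r` in expectation, then `k`
independent steps contract it by `r ^ k`. -/
theorem sum_prod_mul_le_pow_mul {E I : Type*} [Fintype I] (p : I → ℝ) (hp : ∀ i, 0 ≤ p i)
    (f : E → ℝ) (step : I → E → E) (r : ℝ) (hr : 0 ≤ r)
    (hstep : ∀ w, ∑ i, p i * f (step i w) ≤ r * f w) (k : ℕ) (w0 : E)
    (W : (Fin k → I) → Fin (k + 1) → E) (hW0 : ∀ ι, W ι 0 = w0)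
    (hWs : ∀ ι, ∀ t : Fin k, W ι t.succ = step (ι t) (W ι t.castSucc)) :
    ∑ ι : Fin k → I, (∏ t, p (ι t)) * f (W ι (Fin.last k)) ≤ r ^ k * f w0 := by
  induction k generalizing w0 with
  | zero => simp [hW0]
  | succ k ih =>
    rw [← (Fin.consEquiv fun _ => I).sum_comp, Fintype.sum_prod_type]
    calc _ = ∑ i, p i * ∑ ι : Fin k → I,
          (∏ t, p (ι t)) * f (W (Fin.cons i ι) (Fin.last k).succ) := by
          simp [Fin.consEquiv, Fin.prod_univ_succ, Finset.mul_sum, mul_assoc]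
      _ ≤ ∑ i, p i * (r ^ k * f (step i w0)) := by
          refine Finset.sum_le_sum fun i _ => mul_le_mul_of_nonneg_left ?_ (hp i)
          refine ih (step i w0) (fun ι t => W (Fin.cons i ι) t.succ) (fun ι => ?_) fun ι t => ?_
          · have h := hWs (Fin.cons i ι) 0
            simpa [hW0] using h
          · have h := hWs (Fin.cons i ι) t.succ
            simpa using h
      _ = r ^ k * ∑ i, p i * f (step i w0) := by
          rw [Finset.mul_sum]
          exact Finset.sum_congr rfl fun i _ => by ring
      _ ≤ r ^ k * (r * f w0) := mul_le_mul_of_nonneg_left (hstep w0) (pow_nonneg hr k)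
      _ = r ^ (k + 1) * f w0 := by ring

/-- One randomized Kaczmarz step contracts the expected squared error by `1 - c / ‖X‖_F²` whenever
`c` bounds the quadratic form of `XXᵀ` from below. -/
theorem sum_mul_sum_sq_kaczmarz_step_le {m I : Type*} [Fintype m] [Fintype I] (x : I → m → ℝ)
    (hx : ∀ i, ∑ a, x i a ^ 2 ≠ 0) (c : ℝ) (hS : 0 < ∑ j, ∑ a, x j a ^ 2)
    (hc : ∀ e : m → ℝ, c * ∑ a, e a ^ 2 ≤ ∑ i, (∑ a, x i a * e a) ^ 2) (v w : m → ℝ) :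
    ∑ i, (∑ a, x i a ^ 2) / (∑ j, ∑ a, x j a ^ 2) *
        ∑ a, (w a - ((∑ b, x i b * w b) - ∑ b, x i b * v b) / (∑ b, x i b ^ 2) * x i a - v a) ^ 2
      ≤ (1 - c / ∑ j, ∑ a, x j a ^ 2) * ∑ a, (w a - v a) ^ 2 := by
  set S := ∑ j, ∑ a, x j a ^ 2 with hSdef
  have hterm : ∀ i, (∑ a, x i a ^ 2) / S *
      ∑ a, (w a - ((∑ b, x i b * w b) - ∑ b, x i b * v b) / (∑ b, x i b ^ 2) * x i a - v a) ^ 2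
      = (∑ a, x i a ^ 2) * (∑ a, (w a - v a) ^ 2) / S
        - (∑ b, x i b * (w b - v b)) ^ 2 / S := fun i => by
    have hproj := sum_sq_sub_proj (x i) (fun a => w a - v a) (hx i)
    have hqi := hx i
    simp_rw [← Finset.sum_sub_distrib, ← mul_sub, sub_right_comm _ _ (v _)]
    rw [hproj]
    field_simp
  simp_rw [hterm, Finset.sum_sub_distrib, ← Finset.sum_div, ← Finset.sum_mul, ← hSdef]
  rw [mul_div_cancel_left₀ _ hS.ne', sub_mul, one_mul, div_mul_eq_mul_div]
  gcongr
  exact hc _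

/-- Linear convergence of the randomized Kaczmarz method (SGD with importance sampling
`P(i) ∝ ‖xᵢ‖²` and stepsize `1/‖xᵢ‖²`) on a realizable least-squares problem:
`E‖w^k − w*‖² ≤ (1 − μ/(d·λ_avg))^k ‖w⁰ − w*‖²`, where `μ = λ_min((1/n)XXᵀ)` and
`λ_avg = trace((1/n)XXᵀ)/d`. -/
theorem stmt_13 (d n k : ℕ) (hd : 0 < d) (hn : 0 < n)
    (x : Fin n → Fin d → ℝ) (hx : ∀ i, x i ≠ 0)
    (H : Matrix (Fin d) (Fin d) ℝ)
    (hH : H = (n : ℝ)⁻¹ • ∑ i, Matrix.vecMulVec (x i) (x i))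
    (hHerm : H.IsHermitian) (μ : ℝ) (hμ : μ = ⨅ a, hHerm.eigenvalues a)
    (lavg : ℝ) (hlavg : lavg = Matrix.trace H / d)
    (p : Fin n → ℝ) (hp : ∀ i, p i = (∑ a, x i a ^ 2) / ∑ j, ∑ a, x j a ^ 2)
    (wstar : Fin d → ℝ) (y : Fin n → ℝ) (hy : ∀ i, y i = ∑ a, x i a * wstar a)
    (w0 : Fin d → ℝ)
    (W : (Fin k → Fin n) → Fin (k + 1) → Fin d → ℝ)
    (hW0 : ∀ ι, W ι 0 = w0)
    (hWs : ∀ ι, ∀ t : Fin k, W ι t.succ = fun a =>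
      W ι t.castSucc a
        - (((∑ b, x (ι t) b * W ι t.castSucc b) - y (ι t)) / ∑ b, x (ι t) b ^ 2)
            * x (ι t) a) :
    ∑ ι : Fin k → Fin n, (∏ t, p (ι t)) * ∑ a, (W ι (Fin.last k) a - wstar a) ^ 2
      ≤ (1 - μ / (d * lavg)) ^ k * ∑ a, (w0 a - wstar a) ^ 2 := by
  have hq : ∀ i, 0 < ∑ a, x i a ^ 2 := fun i => by
    obtain ⟨a, ha⟩ := Function.ne_iff.1 (hx i)
    exact Finset.sum_pos' (fun b _ => sq_nonneg _) ⟨a, Finset.mem_univ a, by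
      have : x i a ≠ 0 := ha
      positivity⟩
  set S := ∑ j, ∑ a, x j a ^ 2 with hSdef
  have hS : 0 < S := Finset.sum_pos (fun i _ => hq i) ⟨⟨0, hn⟩, Finset.mem_univ _⟩
  have hnR : (0 : ℝ) < n := Nat.cast_pos.2 hn
  have hdR : (0 : ℝ) < d := Nat.cast_pos.2 hd
  have hrate : μ / (d * lavg) = n * μ / S := by
    have htr : H.trace = (n : ℝ)⁻¹ * S := by
      simp [hH, hSdef, Matrix.trace_smul, Matrix.trace_sum, Matrix.trace_vecMulVec, dotProduct, sq]
    rw [hlavg, htr]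
    field_simp
  have hquad : ∀ e : Fin d → ℝ,
      n * μ * ∑ a, e a ^ 2 ≤ ∑ i, (∑ a, x i a * e a) ^ 2 := fun e => by
    have h := hHerm.iInf_eigenvalues_mul_dotProduct_le e
    have hform : e ⬝ᵥ H.mulVec e = (n : ℝ)⁻¹ * ∑ i, (∑ a, x i a * e a) ^ 2 := by
      rw [hH, Matrix.smul_mulVec, dotProduct_smul, Matrix.sum_mulVec, dotProduct_sum, smul_eq_mul]
      congr 1
      refine Finset.sum_congr rfl fun i _ => ?_
      rw [Matrix.vecMulVec_mulVec, dotProduct_smul, dotProduct_comm e]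
      simp [dotProduct, sq]
    have hee : e ⬝ᵥ e = ∑ a, e a ^ 2 := by simp [dotProduct, sq]
    rw [← hμ, hform, hee] at h
    calc n * μ * ∑ a, e a ^ 2 = n * (μ * ∑ a, e a ^ 2) := by ring
      _ ≤ n * ((n : ℝ)⁻¹ * ∑ i, (∑ a, x i a * e a) ^ 2) := mul_le_mul_of_nonneg_left h hnR.le
      _ = _ := by field_simp
  have hp0 : ∀ i, 0 ≤ p i := fun i => by
    rw [hp]
    exact div_nonneg (hq i).le hS.le
  have hstep : ∀ w : Fin d → ℝ,
      ∑ i, p i * ∑ a, (w a - ((∑ b, x i b * w b) - y i) / (∑ b, x i b ^ 2) * x i a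
        - wstar a) ^ 2 ≤ (1 - μ / (d * lavg)) * ∑ a, (w a - wstar a) ^ 2 := fun w => by
    simp_rw [hp, hy, hrate]
    exact sum_mul_sum_sq_kaczmarz_step_le x (fun i => (hq i).ne') _ hS hquad wstar w
  have hr : 0 ≤ 1 - μ / (d * lavg) := by
    have h := hstep fun a => wstar a + 1
    have h0 := le_trans (Finset.sum_nonneg fun i _ =>
      mul_nonneg (hp0 i) (Finset.sum_nonneg fun a _ => sq_nonneg _)) h
    simp only [add_sub_cancel_left, one_pow, Finset.sum_const, Finset.card_univ,
      Fintype.card_fin, nsmul_eq_mul, mul_one] at h0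
    exact nonneg_of_mul_nonneg_left h0 hdR
  exact sum_prod_mul_le_pow_mul p hp0 (fun w : Fin d → ℝ => ∑ a, (w a - wstar a) ^ 2)
    (fun i w a => w a - ((∑ b, x i b * w b) - y i) / (∑ b, x i b ^ 2) * x i a)
    _ hr hstep k w0 W hW0 hWs
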